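/- Let m₋, m₊ ∈ ℤ ± 1/4 with m₊ ≥ m₋ > 0 and m₊ > 1, and let P1 := ∏_{k=δ₊}^{A₊} (1 − q^{2k})²/((1 + q^{k+δ₋})(1 + q^{k−δ₋})(1 − q^{k+δ₊})(1 − q^{k−δ₊})) (factors identically equal to 1 − q⁰ omitted), P2 := ∏_{u ∈ r_e(m₋)} (1 + q^{A₊}u^{−1})(1 + q^{A₊}u)/((1 + q^{A₊+1}u^{−1})(1 + q^{A₊+1}u)), P3 := ∏_{u ∈ r_e(m₊−1)} (1 − q^{A₊}u^{−1})(1 − q^{A₊}u)/((1 − q^{A₊+1}u^{−1})(1 − q^{A₊+1}u)), and, with N = A₊ + 1 − δ₊, P4a := ∏_{1≤i<j≤N}(1 − q^{j−i})²/[∏_{1≤i<j≤N}(1 − q^{j−i+1}) · ∏_{1≤i<j≤N, j−i≥2}(1 − q^{j−i−1})] and P4d := ∏_{1≤i<j≤N}(1 − q^{i+j+2δ₊−2})²/[∏_{1≤i<j≤N}(1 − q^{i+j+2δ₊−1}) · ∏_{1≤i<j≤N, i+j+2δ₊−3≠0}(1 − q^{i+j+2δ₊−3})]. Then there exist c ∈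 ℚ^× and k₀ ∈ ℤ such that P1 · P2 · P3 · P4a · P4d = c · v^{k₀} · (1 − q)^{A₊ + 1 − δ₊} (1 + q)^{(−1)^{1−δ₊} δ₋} / [ ∏_{k=1}^{A₊ − A₋ − 1} (1 + q^{k}) · ∏_{i=0}^{A₋} (1 + q^{A₊ − A₋ + 1 + 2i}) ]. -/

import Mathlib

/-!
STATEMENT 13. The full rank-zero extra-special product:
`P1·P2·P3·P4a·P4d = c · v^{k₀} · (1-q)^{A₊+1-δ₊}(1+q)^{(-1)^{1-δ₊}δ₋} /
  [∏_{k=1}^{A₊-A₋-1}(1+q^k) · ∏_{i=0}^{A₋}(1+q^{A₊-A₋+1+2i})]`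
for some `c ∈ ℚ^×`, `k₀ ∈ ℤ`.  Here `q = v²`, `m₊ ≥ m₋ > 0`, `m₊ > 1`,
`A_± = 2(κ_±-1)+ε_±`, `δ_± = κ_± mod 2`, `N = A₊+1-δ₊`.
-/

noncomputable section

/-- The field `ℚ(v)`; we set `q = v²`. -/
abbrev RF13 : Type := RatFunc ℚ

/-- The indeterminate `v`. -/
def vR : RF13 := RatFunc.X

/-- `q = v²`. -/
def qR : RF13 := RatFunc.X ^ 2

/-- Exponents of the coordinates of `σ_e(m)` for `m = κ + (2ε-1)/4`. -/
def sigmaExp (ε κ : ℕ) : Multiset ℤ := (Finset.Icc ((κ : ℤ) % 2) (2 * (κ : ℤ) - 2 + ε)).val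

/-- Exponents of the coordinates of `r_e(m)` for `m = κ + (2ε-1)/4`. -/
def reExp (ε : ℕ) : ℕ → Multiset ℤ
  | 0 => 0
  | κ + 1 => sigmaExp ε (κ + 1) + reExp ε κ

/-- The pairs `1 ≤ i < j ≤ N`. -/
def pairsUpTo (N : ℕ) : Finset (ℕ × ℕ) :=
  (Finset.Icc 1 N ×ˢ Finset.Icc 1 N).filter fun p => p.1 < p.2

/-- The factor `(P1)` (regularized: factors identically `1 - q⁰` omitted). -/
def P1Expr (δm δp : ℕ) (A : ℤ) : RF13 :=
  ∏ k ∈ Finset.Icc (δp : ℤ) A,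
    ((if k = 0 then 1 else (1 - qR ^ (2 * k)) ^ 2) /
      ((1 + qR ^ (k + δm)) * (1 + qR ^ (k - δm)) *
        (if k + δp = 0 then 1 else 1 - qR ^ (k + δp)) *
        (if k = (δp : ℤ) then 1 else 1 - qR ^ (k - δp))))

/-- The factor `(P2)`, a product over the coordinates `u ∈ r_e(m₋)`. -/
def P2Expr (εm κm : ℕ) (A : ℤ) : RF13 :=
  ((reExp εm κm).map fun e =>
      (1 + qR ^ A * (qR ^ e)⁻¹) * (1 + qR ^ A * qR ^ e) /
        ((1 + qR ^ (A + 1) * (qR ^ e)⁻¹) * (1 + qR ^ (A + 1) * qR ^ e))).prod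

/-- The factor `(P3)`, a product over the coordinates `u ∈ r_e(m₊-1)`. -/
def P3Expr (εp κp : ℕ) (A : ℤ) : RF13 :=
  ((reExp εp (κp - 1)).map fun e =>
      (1 - qR ^ A * (qR ^ e)⁻¹) * (1 - qR ^ A * qR ^ e) /
        ((1 - qR ^ (A + 1) * (qR ^ e)⁻¹) * (1 - qR ^ (A + 1) * qR ^ e))).prod

/-- The factor `(P4a)`. -/
def P4aExpr (N : ℕ) : RF13 :=
  (∏ p ∈ pairsUpTo N, (1 - qR ^ (p.2 - p.1)) ^ 2) /
    ((∏ p ∈ pairsUpTo N, (1 - qR ^ (p.2 - p.1 + 1))) *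
      ∏ p ∈ (pairsUpTo N).filter (fun p => 2 ≤ p.2 - p.1), (1 - qR ^ (p.2 - p.1 - 1)))

/-- The factor `(P4d)`, with `N = A + 1 - δ`. -/
def P4dExpr (δ A : ℕ) : RF13 :=
  (∏ p ∈ pairsUpTo (A + 1 - δ), (1 - qR ^ (p.1 + p.2 + 2 * δ - 2)) ^ 2) /
    ((∏ p ∈ pairsUpTo (A + 1 - δ), (1 - qR ^ (p.1 + p.2 + 2 * δ - 1))) *
      ∏ p ∈ (pairsUpTo (A + 1 - δ)).filter (fun p => p.1 + p.2 + 2 * δ - 3 ≠ 0),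
        (1 - qR ^ (p.1 + p.2 + 2 * δ - 3)))

section EvenSequences

variable {K : Type*} [CommGroupWithZero K]

theorem prod_Icc_int_eq_div (F H : ℤ → K) (hH : ∀ k, H k ≠ 0)
    (hF : ∀ k, F k = H (k + 1) / H k) {a b : ℤ} (hab : a ≤ b + 1) :
    ∏ k ∈ Finset.Icc a b, F k = H (b + 1) / H a := by
  obtain ⟨n, hn⟩ := Int.le.dest hab
  induction n generalizing b with
  | zero =>
    have hb : b + 1 = a := by simpa using hn.symm
    rw [hb, div_self (hH a), Finset.Icc_eq_empty (by omega), Finset.prod_empty]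
  | succ n ih =>
    have hb : b = (b - 1) + 1 := by ring
    have hs : Finset.Icc a b = insert b (Finset.Icc a (b - 1)) := by
      ext x; simp only [Finset.mem_Icc, Finset.mem_insert]; push_cast at hn; omega
    rw [hs, Finset.prod_insert (by simp), ih (b := b - 1) (by push_cast at hn; omega)
      (by push_cast at hn; omega), hF, ← hb]
    have h1 := hH b
    have h2 := hH a
    field_simp

theorem prod_Icc_one_int_eq_prod_range (g : ℤ → K) (b : ℤ) :
    ∏ k ∈ Finset.Icc (1 : ℤ) b, g k = ∏ k ∈ Finset.range b.toNat, g (k + 1) := by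
  refine (Finset.prod_nbij (fun k : ℕ => (k : ℤ) + 1) ?_ ?_ ?_ ?_).symm
  · intro k hk; simp only [Finset.mem_range, Finset.mem_Icc] at *; omega
  · intro x _ y _ h; simpa using h
  · intro k hk
    simp only [Finset.coe_Icc, Set.mem_Icc, Finset.coe_range, Set.mem_image, Set.mem_Iio] at *
    exact ⟨(k - 1).toNat, by omega, by omega⟩
  · intro k _; rfl

theorem prod_Icc_zero_int_eq_prod_range (g : ℤ → K) (b : ℤ) :
    ∏ k ∈ Finset.Icc (0 : ℤ) b, g k = ∏ k ∈ Finset.range (b + 1).toNat, g k := by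
  refine (Finset.prod_nbij (fun k : ℕ => (k : ℤ)) ?_ ?_ ?_ ?_).symm
  · intro k hk; simp only [Finset.mem_range, Finset.mem_Icc] at *; omega
  · intro x _ y _ h; simpa using h
  · intro k hk
    simp only [Finset.coe_Icc, Set.mem_Icc, Finset.coe_range, Set.mem_image, Set.mem_Iio] at *
    exact ⟨k.toNat, by omega, by omega⟩
  · intro k _; rfl

theorem prod_sigmaExp (g : ℤ → K) (hg : ∀ n, g n ≠ 0) (ε κ : ℕ) (hκ : 1 ≤ κ) (a : ℤ) :
    ((sigmaExp ε κ).map fun e =>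
        g (a - e) * g (a + e) / (g (a + 1 - e) * g (a + 1 + e))).prod =
      g (a - (2 * κ - 2 + ε)) * g (a + (κ : ℤ) % 2) /
        (g (a + 1 + (2 * κ - 2 + ε)) * g (a + 1 - (κ : ℤ) % 2)) := by
  change ∏ e ∈ Finset.Icc ((κ : ℤ) % 2) (2 * (κ : ℤ) - 2 + ε),
    g (a - e) * g (a + e) / (g (a + 1 - e) * g (a + 1 + e)) = _
  rw [prod_Icc_int_eq_div _ (fun e => g (a + 1 - e) / g (a + e))
    (fun e => div_ne_zero (hg _) (hg _)) ?_ (by omega)]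
  · rw [show a + 1 - (2 * (κ : ℤ) - 2 + ε + 1) = a - (2 * κ - 2 + ε) by ring,
      show a + (2 * (κ : ℤ) - 2 + ε + 1) = a + 1 + (2 * κ - 2 + ε) by ring]
    field_simp [hg]
  · intro e
    rw [show a + 1 - (e + 1) = a - e by ring, show a + (e + 1) = a + 1 + e by ring]
    field_simp [hg]

theorem prod_reExp (g : ℤ → K) (hg : ∀ n, g n ≠ 0) (ε κ : ℕ) (a : ℤ) :
    ((reExp ε κ).map fun e =>
        g (a - e) * g (a + e) / (g (a + 1 - e) * g (a + 1 + e))).prod =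
      (g (a + 1) / g a) ^ (κ % 2) *
        ∏ j ∈ Finset.range κ, (g (a - (2 * j + ε)) / g (a + 1 + (2 * j + ε))) := by
  induction κ with
  | zero => simp [reExp]
  | succ κ ih =>
    rw [reExp, Multiset.map_add, Multiset.prod_add, ih, prod_sigmaExp g hg ε (κ + 1) (by omega),
      Finset.prod_range_succ]
    rw [show 2 * ((κ + 1 : ℕ) : ℤ) - 2 + ε = 2 * κ + ε by push_cast; ring]
    have h0 := hg (a + 1 + (2 * κ + ε))
    have h1 := hg a
    have h2 := hg (a + 1)
    rcases Nat.mod_two_eq_zero_or_one κ with h | h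
    · rw [h, show (κ + 1) % 2 = 1 by omega, show ((κ + 1 : ℕ) : ℤ) % 2 = 1 by omega,
        show a + 1 - 1 = a by ring]
      field_simp
    · rw [h, show (κ + 1) % 2 = 0 by omega, show ((κ + 1 : ℕ) : ℤ) % 2 = 0 by omega,
        add_zero, sub_zero]
      field_simp

theorem mem_reExp {ε κ : ℕ} {e : ℤ} (he : e ∈ reExp ε κ) : 0 ≤ e ∧ e ≤ 2 * κ - 2 + ε := by
  induction κ with
  | zero => simp [reExp] at he
  | succ κ ih =>
    rw [reExp, Multiset.mem_add] at he
    rcases he with he | he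
    · have := Finset.mem_Icc.1 (show e ∈ Finset.Icc _ _ from he)
      omega
    · have := ih he
      push_cast
      omega

theorem prod_pairsUpTo (F : ℕ × ℕ → K) (N : ℕ) :
    ∏ p ∈ pairsUpTo N, F p =
      ∏ j ∈ Finset.range N, ∏ i ∈ Finset.range j, F (i + 1, j + 1) := by
  rw [Finset.prod_sigma']
  refine (Finset.prod_nbij (fun x : (_ : ℕ) × ℕ => (x.2 + 1, x.1 + 1)) ?_ ?_ ?_ ?_).symm
  · rintro ⟨j, i⟩ h
    simp only [Finset.mem_sigma, Finset.mem_range, pairsUpTo, Finset.mem_filter,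
      Finset.mem_product, Finset.mem_Icc] at *
    omega
  · rintro ⟨j, i⟩ _ ⟨j', i'⟩ _ h
    simp only [Prod.mk.injEq, add_left_inj] at h
    rw [h.1, h.2]
  · rintro ⟨i, j⟩ h
    simp only [Finset.coe_sigma, pairsUpTo, Finset.coe_filter, Finset.mem_product,
      Finset.mem_Icc, Set.mem_ofPred_eq, Set.mem_image] at h ⊢
    refine ⟨⟨j - 1, i - 1⟩, ?_, ?_⟩
    · simp only [Set.mem_sigma_iff, Finset.mem_coe, Finset.mem_range]
      omega
    · simp only [Prod.mk.injEq]
      omega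
  · intro _ _; rfl

theorem prod_pairs_sub (f : ℤ → K) (hf : ∀ n, f n ≠ 0) (hf0 : f 0 = 1) (N : ℕ) :
    ∏ j ∈ Finset.range N, ∏ i ∈ Finset.range j,
        f (j - i) ^ 2 / (f (j - i + 1) * f (j - i - 1)) = f 1 ^ N / f N := by
  have key (j : ℤ) (n : ℕ) : ∏ i ∈ Finset.range n, f (j - i) ^ 2 /
      (f (j - i + 1) * f (j - i - 1)) = f (j - n + 1) * f j / (f (j - n) * f (j + 1)) := by
    induction n with
    | zero => field_simp [hf]; simp [mul_comm]
    | succ n ih =>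
      rw [Finset.prod_range_succ, ih]
      push_cast
      rw [show j - (n + 1 : ℤ) + 1 = j - n by ring, show j - (n + 1 : ℤ) = j - n - 1 by ring]
      field_simp [hf]
  induction N with
  | zero => simp [hf0]
  | succ N ih =>
    rw [Finset.prod_range_succ, ih, key, sub_self, hf0, zero_add]
    push_cast
    field_simp [hf]
    rw [pow_succ]

theorem prod_pairs_add (f : ℤ → K) (hf : ∀ n, f n ≠ 0) (d : ℤ) (N : ℕ) :
    ∏ j ∈ Finset.range N, ∏ i ∈ Finset.range j,
        f (i + j + 2 * d) ^ 2 / (f (i + j + 2 * d + 1) * f (i + j + 2 * d - 1)) =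
      f (N + 2 * d - 1) / f (2 * N + 2 * d - 1) *
        ∏ i ∈ Finset.range N, f (2 * (i + d) + 1) / f (2 * (i + d)) := by
  have key (j : ℤ) (n : ℕ) : ∏ i ∈ Finset.range n, f (i + j + 2 * d) ^ 2 /
      (f (i + j + 2 * d + 1) * f (i + j + 2 * d - 1)) =
        f (j + 2 * d) * f (n + j + 2 * d - 1) / (f (j + 2 * d - 1) * f (n + j + 2 * d)) := by
    induction n with
    | zero => field_simp [hf]; simp [mul_comm]
    | succ n ih =>
      rw [Finset.prod_range_succ, ih]
      push_cast
      rw [show (n + 1 : ℤ) + j + 2 * d - 1 = n + j + 2 * d by ring,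
        show (n + 1 : ℤ) + j + 2 * d = n + j + 2 * d + 1 by ring]
      field_simp [hf]
  induction N with
  | zero => simp [hf]
  | succ N ih =>
    rw [Finset.prod_range_succ, ih, key, Finset.prod_range_succ]
    push_cast
    rw [show (N + 1 : ℤ) + 2 * d - 1 = N + 2 * d by ring,
      show 2 * (N + 1 : ℤ) + 2 * d - 1 = 2 * (N + d) + 1 by ring,
      show (N : ℤ) + N + 2 * d - 1 = 2 * N + 2 * d - 1 by ring,
      show (N : ℤ) + N + 2 * d = 2 * (N + d) by ring]
    field_simp [hf]

theorem prod_range_parity (f : ℤ → K) (ε t : ℕ) (hε : ε = 0 ∨ ε = 1) :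
    ∏ k ∈ Finset.range (2 * t + ε), f (k + 1) =
      (∏ k ∈ Finset.range (t + ε), f (2 * k + 1)) * ∏ j ∈ Finset.range t, f (2 * (j + 1)) := by
  have even : ∏ k ∈ Finset.range (2 * t), f (k + 1) =
      (∏ k ∈ Finset.range t, f (2 * k + 1)) * ∏ j ∈ Finset.range t, f (2 * (j + 1)) := by
    induction t with
    | zero => simp
    | succ t ih =>
      rw [show 2 * (t + 1) = 2 * t + 1 + 1 by ring, Finset.prod_range_succ,
        Finset.prod_range_succ, ih, Finset.prod_range_succ, Finset.prod_range_succ]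
      push_cast
      rw [show 2 * (t : ℤ) + 1 + 1 = 2 * (t + 1) by ring]
      ac_rfl
  rcases hε with rfl | rfl
  · exact even
  · rw [Finset.prod_range_succ, Finset.prod_range_succ, even]
    push_cast
    ac_rfl

theorem prod_double_eq_inv (f g : ℤ → K) (hf : ∀ n, f n ≠ 0) (hg : ∀ n, g n ≠ 0)
    (hf0 : f 0 = 1) (hfg : ∀ n, f (2 * n) = f n * g n) (ε t A : ℕ) (hε : ε = 0 ∨ ε = 1)
    (hA : A = 2 * t + ε) :
    (∏ j ∈ Finset.range t, f (A - (2 * j + ε)) / f (A + 1 + (2 * j + ε))) / f (2 * A + 1) *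
        ∏ k ∈ Finset.range (A + 1), f (2 * k + 1) / f (2 * k) =
      (∏ n ∈ Finset.range A, g (n + 1))⁻¹ := by
  have hP (F : ℤ → K) (hF : ∀ n, F n ≠ 0) (s : Finset ℕ) (u : ℕ → ℤ) :
      ∏ k ∈ s, F (u k) ≠ 0 := Finset.prod_ne_zero_iff.2 fun _ _ => hF _
  have e1 : ∏ j ∈ Finset.range t, f (A - (2 * j + ε)) = ∏ j ∈ Finset.range t, f (2 * (j + 1)) := by
    rw [← Finset.prod_range_reflect]
    refine Finset.prod_congr rfl fun j hj => ?_
    rw [Finset.mem_range] at hj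
    congr 1
    omega
  have e2 : ∏ k ∈ Finset.range (A + 1), f (2 * k + 1) =
      (∏ k ∈ Finset.range (t + ε), f (2 * k + 1)) *
        (∏ j ∈ Finset.range t, f (A + 1 + (2 * j + ε))) * f (2 * A + 1) := by
    rw [Finset.prod_range_succ, show Finset.range A = Finset.range (t + ε + t) by congr 1; omega,
      Finset.prod_range_add]
    congr 2
    refine Finset.prod_congr rfl fun j _ => ?_
    congr 1
    rw [hA]
    push_cast
    ring
  have e3 : ∏ k ∈ Finset.range (A + 1), f (2 * k) =
      (∏ k ∈ Finset.range A, f (k + 1)) * ∏ k ∈ Finset.range A, g (k + 1) := by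
    rw [Finset.prod_range_succ', ← Finset.prod_mul_distrib]
    simp [hf0, ← hfg]
  have e4 := prod_range_parity f ε t hε
  rw [← hA] at e4
  rw [Finset.prod_div_distrib, Finset.prod_div_distrib, e1, e2, e3, e4]
  have h1 := hP f hf (Finset.range t) (fun j => 2 * (j + 1))
  have h2 := hP f hf (Finset.range t) (fun j => A + 1 + (2 * j + ε))
  have h3 := hP f hf (Finset.range (t + ε)) (fun j => 2 * j + 1)
  have h4 := hP g hg (Finset.range A) (fun j => j + 1)
  have h5 := hf (2 * A + 1)
  field_simp

theorem prod_range_eq_overlap (g : ℤ → K) (hg0 : g 0 = 1) (A κ ε n h : ℕ)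
    (hε : ε = 0 ∨ ε = 1) (hn : n + 1 = 2 * κ + ε) (hh : h + n = A + 1) :
    (∏ k ∈ Finset.range A, g (k + 1)) * ∏ j ∈ Finset.range κ, g (A + 1 + (2 * j + ε)) =
      (∏ j ∈ Finset.range κ, g (A - (2 * j + ε))) *
        ((∏ k ∈ Finset.range (h - 1), g (k + 1)) * ∏ i ∈ Finset.range n, g (h + 1 + 2 * i)) := by
  induction κ generalizing n h with
  | zero =>
    obtain rfl : n = 0 := by omega
    obtain rfl : h = A + 1 := by omega
    simp
  | succ κ ih =>
    by_cases hn1 : n = 1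
    · obtain rfl : κ = 0 := by omega
      obtain rfl : ε = 0 := by omega
      obtain rfl : h = A := by omega
      subst hn1
      rcases h with - | h
      · simp [hg0]
      · simp [Finset.prod_range_succ, add_assoc, mul_comm, mul_left_comm]
    · obtain ⟨n, rfl⟩ : ∃ n', n = n' + 2 := ⟨n - 2, by omega⟩
      have step := ih n (h + 2) (by omega) (by omega)
      have e : ∏ k ∈ Finset.range (h + 2 - 1), g (k + 1) =
          (∏ k ∈ Finset.range (h - 1), g (k + 1)) * g h * g (h + 1) := by
        rcases h with - | h
        · simp [hg0]
        · simp [Finset.prod_range_succ]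
      have e' : A - (2 * κ + ε) = (h : ℤ) := by omega
      rw [Finset.prod_range_succ, ← mul_assoc, step, e, Finset.prod_range_succ _ κ, e',
        Finset.prod_range_succ _ (n + 1), Finset.prod_range_succ']
      have e'' : ∀ k : ℕ, (h : ℤ) + 1 + 2 * ((k + 1 : ℕ) : ℤ) = ((h + 2 : ℕ) : ℤ) + 1 + 2 * k := by
        intro k; push_cast; ring
      simp only [e'']
      rw [show ((h + 2 : ℕ) : ℤ) + 1 + 2 * n = A + 1 + (2 * κ + ε) by push_cast; omega]
      simp only [Nat.cast_zero, mul_zero, add_zero]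
      ac_rfl

end EvenSequences

section EvenSequencesAssembly

variable {K : Type*} [CommGroupWithZero K]

theorem prod_Icc_sq_div (h : ℤ → K) (hh : ∀ n, h n ≠ 0) {a b : ℤ} (hab : a ≤ b + 1) (d : ℕ)
    (hd : d = 0 ∨ d = 1) :
    ∏ k ∈ Finset.Icc a b, h k ^ 2 / (h (k + d) * h (k - d)) =
      (h b / h (b + 1) * (h a / h (a - 1))) ^ d := by
  rcases hd with rfl | rfl
  · rw [pow_zero]
    exact Finset.prod_eq_one fun k _ => by simp [pow_two, hh]
  · rw [prod_Icc_int_eq_div _ (fun k => h (k - 1) / h k)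
      (fun k => div_ne_zero (hh _) (hh _)) ?_ hab]
    · rw [add_sub_cancel_right, pow_one]
      field_simp [hh]
    · intro k
      rw [add_sub_cancel_right, Nat.cast_one]
      field_simp [hh]

theorem even_prod_identity (f g : ℤ → K) (hf : ∀ n, f n ≠ 0) (hg : ∀ n, g n ≠ 0)
    (hf0 : f 0 = 1) (hg0 : g 0 = 1) (hgneg : ∀ n, g (-n) = g n)
    (hfg : ∀ n, f (2 * n) = f n * g n)
    (κm t εm εp δm δp A n h : ℕ) (hεm : εm = 0 ∨ εm = 1) (hεp : εp = 0 ∨ εp = 1)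
    (hδm : δm = κm % 2) (hδp : δp = (t + 1) % 2) (hA : A = 2 * t + εp)
    (hn : n + 1 = 2 * κm + εm) (hh : h + n = A + 1) :
    (∏ k ∈ Finset.Icc (δp : ℤ) A,
        f (2 * k) ^ 2 / (g (k + δm) * g (k - δm) * f (k + δp) * f (k - δp))) *
      ((reExp εm κm).map fun e =>
        g (A - e) * g (A + e) / (g (A + 1 - e) * g (A + 1 + e))).prod *
      ((reExp εp t).map fun e =>
        f (A - e) * f (A + e) / (f (A + 1 - e) * f (A + 1 + e))).prod *
      (∏ j ∈ Finset.range (A + 1 - δp), ∏ i ∈ Finset.range j,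
        f (j - i) ^ 2 / (f (j - i + 1) * f (j - i - 1))) *
      (∏ j ∈ Finset.range (A + 1 - δp), ∏ i ∈ Finset.range j,
        f (i + j + 2 * δp) ^ 2 / (f (i + j + 2 * δp + 1) * f (i + j + 2 * δp - 1))) =
    f 1 ^ (A + 1 - δp) * g 1 ^ ((-1 : ℤ) ^ (1 - δp) * (δm : ℤ)) /
      ((∏ k ∈ Finset.range (h - 1), g (k + 1)) * ∏ i ∈ Finset.range n, g (h + 1 + 2 * i)) := by
  have hP (s : Finset ℕ) (u : ℕ → ℤ) : ∏ k ∈ s, g (u k) ≠ 0 :=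
    Finset.prod_ne_zero_iff.2 fun _ _ => hg _
  have hδm' : δm = 0 ∨ δm = 1 := by omega
  have hδp' : δp = 0 ∨ δp = 1 := by omega
  have e1 : ∏ k ∈ Finset.Icc (δp : ℤ) A,
      f (2 * k) ^ 2 / (g (k + δm) * g (k - δm) * f (k + δp) * f (k - δp)) =
      (g A / g (A + 1) * (g δp / g (δp - 1))) ^ δm *
        (f A / f (A + 1) * (f δp / f (δp - 1))) ^ δp := by
    rw [← prod_Icc_sq_div g hg (by omega) δm hδm', ← prod_Icc_sq_div f hf (by omega) δp hδp',
      ← Finset.prod_mul_distrib]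
    refine Finset.prod_congr rfl fun k _ => ?_
    rw [hfg]
    field_simp [hf, hg]
  have e2 : (g δp / g (δp - 1)) ^ δm = g 1 ^ ((-1 : ℤ) ^ (1 - δp) * (δm : ℤ)) := by
    rcases hδp' with h0 | h0 <;> rcases hδm' with h1 | h1 <;> simp [h0, h1, hg0, hgneg]
  have e3 : f 1 ^ δp * ∏ i ∈ Finset.range (A + 1 - δp), f (2 * (i + δp) + 1) / f (2 * (i + δp)) =
      ∏ k ∈ Finset.range (A + 1), f (2 * k + 1) / f (2 * k) := by
    rcases hδp' with h0 | h0
    · simp [h0]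
    · subst h0
      rw [Finset.prod_range_succ' _ A]
      simp [hf0, mul_comm]
  have hN : ((A + 1 - δp : ℕ) : ℤ) = A + 1 - δp := by omega
  have e4 := prod_double_eq_inv f g hf hg hf0 hfg εp t A hεp hA
  have e5 := prod_range_eq_overlap g hg0 A κm εm n h hεm hn hh
  have e6 : (f (A + 1) / f A) ^ (t % 2) * (f A / f (A + 1) * (f δp / f (δp - 1))) ^ δp *
      (f (A + δp) / f (A + 1 - δp)) = f 1 ^ δp := by
    rcases hδp' with h0 | h0
    · rw [show t % 2 = 1 by omega, h0]
      simp [hf]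
    · rw [show t % 2 = 0 by omega, h0]
      simp [hf0]
      field_simp [hf]
  rw [e1, prod_reExp g hg, prod_reExp f hf, prod_pairs_sub f hf hf0, prod_pairs_add f hf, hN,
    show (A : ℤ) + 1 - δp + 2 * δp - 1 = A + δp by ring,
    show 2 * ((A : ℤ) + 1 - δp) + 2 * δp - 1 = 2 * A + 1 by ring, ← hδm]
  rw [← e3, ← e6] at e4
  rw [mul_pow (g A / _), e2, Finset.prod_div_distrib]
  set G := g 1 ^ ((-1 : ℤ) ^ (1 - δp) * (δm : ℤ))
  set S := ∏ i ∈ Finset.range (A + 1 - δp), f (2 * (i + δp) + 1) / f (2 * (i + δp))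
  set T := ∏ j ∈ Finset.range t, (f (A - (2 * j + εp)) / f (A + 1 + (2 * j + εp)))
  set U := (f A / f (A + 1) * (f δp / f (δp - 1))) ^ δp
  set V := (f (A + 1) / f A) ^ (t % 2)
  have e7 : (g A / g (A + 1)) ^ δm * (g (A + 1) / g A) ^ δm = 1 := by
    rw [← mul_pow, div_mul_div_cancel₀ (hg _), div_self (hg _), one_pow]
  have hb := hP (Finset.range κm) (fun j => A + 1 + (2 * j + εm))
  have hc := hP (Finset.range (h - 1)) (fun k => k + 1)
  have hd := hP (Finset.range n) (fun i => h + 1 + 2 * i)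
  have ha := hP (Finset.range A) (fun k => k + 1)
  set X := ∏ j ∈ Finset.range κm, g (A - (2 * j + εm))
  set Y := ∏ j ∈ Finset.range κm, g (A + 1 + (2 * j + εm))
  set Z := ∏ k ∈ Finset.range A, g (k + 1)
  set W := ∏ k ∈ Finset.range (h - 1), g (k + 1)
  set W' := ∏ i ∈ Finset.range n, g (h + 1 + 2 * i)
  have e8 : X / Y * Z⁻¹ = (W * W')⁻¹ := by
    rw [div_mul_eq_mul_div, div_eq_iff hb, ← div_eq_mul_inv, div_eq_iff ha,
      inv_mul_eq_div, div_mul_eq_mul_div, eq_div_iff (mul_ne_zero hc hd), ← e5, mul_comm]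
  have e9 : ∀ α β γ U V Q T F u v w S : K,
      α * γ * U * (β * Q) * (V * T) * (F / u) * (v / w * S) =
        α * β * (F * γ) * (Q * (T / w * (V * U * (v / u) * S))) := by
    intros
    simp only [div_eq_mul_inv]
    ac_rfl
  rw [e9, e4, e7, e8, one_mul, ← div_eq_mul_inv]

end EvenSequencesAssembly

/-- The units of `ℚ(v)` of the form `c v ^ k` with `c ∈ ℚ^×` and `k ∈ ℤ`. -/
def scalarMonomials : Subgroup RF13ˣ where
  carrier := {u | ∃ c : ℚ, c ≠ 0 ∧ ∃ k : ℤ, (u : RF13) = algebraMap ℚ RF13 c * vR ^ k}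
  one_mem' := ⟨1, one_ne_zero, 0, by simp⟩
  mul_mem' := by
    rintro a b ⟨c, hc, k, h⟩ ⟨d, hd, l, h'⟩
    refine ⟨c * d, mul_ne_zero hc hd, k + l, ?_⟩
    rw [Units.val_mul, h, h', map_mul, zpow_add₀ RatFunc.X_ne_zero]
    exact mul_mul_mul_comm _ _ _ _
  inv_mem' := by
    rintro a ⟨c, hc, k, h⟩
    refine ⟨c⁻¹, inv_ne_zero hc, -k, ?_⟩
    rw [Units.val_inv_eq_inv_val, h, mul_inv, map_inv₀, zpow_neg]

/-- The quotient of `ℚ(v)` by the multiplicative action of the scalar monomials. -/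
def ScalarClass : Type := WithZero (RF13ˣ ⧸ scalarMonomials)

instance : CommGroupWithZero ScalarClass :=
  inferInstanceAs (CommGroupWithZero (WithZero (RF13ˣ ⧸ scalarMonomials)))

open scoped Classical in
/-- Reduction of `ℚ(v)` modulo the scalar monomials. -/
def modScalars : RF13 →*₀ ScalarClass :=
  (WithZero.map' (QuotientGroup.mk' scalarMonomials)).comp
    (WithZero.withZeroUnitsEquiv (G := RF13)).symm.toMonoidWithZeroHom

open scoped Classical in
theorem modScalars_coe (u : RF13ˣ) :
    modScalars u = ((u : RF13ˣ ⧸ scalarMonomials) : WithZero (RF13ˣ ⧸ scalarMonomials)) := by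
  change WithZero.map' (QuotientGroup.mk' scalarMonomials)
    (WithZero.withZeroUnitsEquiv.symm (u : RF13)) = _
  rw [WithZero.withZeroUnitsEquiv_symm_apply_coe]
  rfl

theorem modScalars_coe_eq_iff (u w : RF13ˣ) :
    modScalars u = modScalars w ↔ u⁻¹ * w ∈ scalarMonomials := by
  rw [modScalars_coe, modScalars_coe]
  exact WithZero.coe_inj.trans QuotientGroup.eq

theorem exists_eq_of_modScalars_eq {x y : RF13} (h : modScalars x = modScalars y) :
    ∃ c : ℚ, c ≠ 0 ∧ ∃ k : ℤ, x = algebraMap ℚ RF13 c * vR ^ k * y := by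
  by_cases hx : x = 0
  · subst hx
    rw [map_zero, eq_comm, map_eq_zero] at h
    exact ⟨1, one_ne_zero, 0, by simp [h]⟩
  have hy : y ≠ 0 := by
    rintro rfl
    rw [map_zero, map_eq_zero] at h
    exact hx h
  lift x to RF13ˣ using IsUnit.mk0 x hx
  lift y to RF13ˣ using IsUnit.mk0 y hy
  rw [eq_comm, modScalars_coe_eq_iff] at h
  obtain ⟨c, hc, k, h⟩ := h
  refine ⟨c, hc, k, ?_⟩
  rw [← h, Units.val_mul, mul_comm, Units.mul_inv_cancel_left]

theorem modScalars_monomial {c : ℚ} (hc : c ≠ 0) (k : ℤ) :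
    modScalars (algebraMap ℚ RF13 c * vR ^ k) = 1 := by
  have h0 : algebraMap ℚ RF13 c * vR ^ k ≠ 0 :=
    mul_ne_zero (by simpa using hc) (zpow_ne_zero _ RatFunc.X_ne_zero)
  rw [← map_one modScalars, ← Units.val_mk0 h0, ← Units.val_one, eq_comm, modScalars_coe_eq_iff]
  exact ⟨c, hc, k, by simp⟩

theorem qR_ne_zero : qR ≠ 0 := pow_ne_zero _ RatFunc.X_ne_zero

theorem qR_zpow_eq_vR_zpow (n : ℤ) : qR ^ n = vR ^ (2 * n) := by
  rw [zpow_mul]; rfl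

theorem qR_zpow_ne_one {n : ℤ} (hn : n ≠ 0) : qR ^ n ≠ 1 := by
  have hpow : ∀ m : ℕ, m ≠ 0 → qR ^ m ≠ 1 := by
    intro m hm h
    rw [qR, ← pow_mul, ← RatFunc.algebraMap_X, ← map_pow,
      ← map_one (algebraMap (Polynomial ℚ) RF13)] at h
    have := congrArg Polynomial.natDegree (RatFunc.algebraMap_injective ℚ h)
    rw [Polynomial.natDegree_X_pow, Polynomial.natDegree_one] at this
    omega
  intro h
  refine hpow n.natAbs (Int.natAbs_ne_zero.2 hn) ?_
  rcases Int.natAbs_eq n with h' | h'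
  · rwa [h', zpow_natCast] at h
  · rwa [h', zpow_neg, zpow_natCast, inv_eq_one] at h

theorem one_add_qR_zpow_ne_zero (n : ℤ) : 1 + qR ^ n ≠ 0 := by
  intro h
  by_cases hn : n = 0
  · subst hn
    norm_num at h
  · refine qR_zpow_ne_one (n := n * 2) (by omega) ?_
    rw [zpow_mul, eq_neg_of_add_eq_zero_right h]
    norm_num

/-- The class of `1 - q ^ n`, with the convention that it is `1` when `n = 0`. -/
def oneSubClass (n : ℤ) : ScalarClass :=
  if n = 0 then 1 else modScalars (1 - qR ^ n)

/-- The class of `1 + q ^ n`. -/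
def oneAddClass (n : ℤ) : ScalarClass := modScalars (1 + qR ^ n)

theorem oneSubClass_of_ne_zero {n : ℤ} (hn : n ≠ 0) :
    oneSubClass n = modScalars (1 - qR ^ n) := if_neg hn

theorem oneSubClass_zero : oneSubClass 0 = 1 := if_pos rfl

theorem modScalars_ite (n : ℤ) (p : Prop) [Decidable p] (hp : p ↔ n = 0) :
    modScalars (if p then 1 else 1 - qR ^ n) = oneSubClass n := by
  unfold oneSubClass
  by_cases h : n = 0 <;> simp [hp, h]

theorem oneSubClass_ne_zero (n : ℤ) : oneSubClass n ≠ 0 := by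
  unfold oneSubClass
  split_ifs with h
  · exact one_ne_zero
  · rw [map_ne_zero]
    exact sub_ne_zero.2 (qR_zpow_ne_one h).symm

theorem oneAddClass_ne_zero (n : ℤ) : oneAddClass n ≠ 0 :=
  (map_ne_zero _).2 (one_add_qR_zpow_ne_zero n)

theorem oneAddClass_zero : oneAddClass 0 = 1 := by
  rw [← modScalars_monomial (two_ne_zero (α := ℚ)) 0, oneAddClass]
  congr 1
  norm_num

theorem oneAddClass_neg (n : ℤ) : oneAddClass (-n) = oneAddClass n := by
  have h : 1 + qR ^ n = algebraMap ℚ RF13 1 * vR ^ (2 * n) * (1 + qR ^ (-n)) := by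
    rw [← qR_zpow_eq_vR_zpow, map_one, zpow_neg, one_mul, mul_add,
      mul_inv_cancel₀ (zpow_ne_zero _ qR_ne_zero)]
    ring
  rw [oneAddClass, oneAddClass, h, map_mul, modScalars_monomial one_ne_zero, one_mul]

theorem oneSubClass_two_mul (n : ℤ) : oneSubClass (2 * n) = oneSubClass n * oneAddClass n := by
  by_cases h : n = 0
  · subst h
    rw [mul_zero, oneSubClass_zero, oneAddClass_zero, one_mul]
  · rw [oneSubClass_of_ne_zero (by omega), oneSubClass_of_ne_zero h, oneAddClass, ← map_mul,
      two_mul, zpow_add₀ qR_ne_zero]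
    congr 1
    ring

theorem modScalars_multiset_prod (s : Multiset ℤ) (F : ℤ → RF13) :
    modScalars (s.map F).prod = (s.map fun e => modScalars (F e)).prod := by
  rw [map_multiset_prod, Multiset.map_map]
  rfl

theorem modScalars_P1Expr (δm δp : ℕ) (A : ℤ) :
    modScalars (P1Expr δm δp A) = ∏ k ∈ Finset.Icc (δp : ℤ) A,
      oneSubClass (2 * k) ^ 2 / (oneAddClass (k + δm) * oneAddClass (k - δm) *
        oneSubClass (k + δp) * oneSubClass (k - δp)) := by
  rw [P1Expr, map_prod]
  refine Finset.prod_congr rfl fun k _ => ?_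
  have h : (if k = 0 then (1 : RF13) else (1 - qR ^ (2 * k)) ^ 2) =
      (if k = 0 then 1 else 1 - qR ^ (2 * k)) ^ 2 := by split_ifs <;> simp
  rw [h, map_div₀, map_pow, map_mul, map_mul, map_mul, modScalars_ite (2 * k) _ (by omega),
    modScalars_ite (k + δp) _ Iff.rfl, modScalars_ite (k - δp) _ (by omega)]
  rfl

theorem modScalars_P2Expr (ε κ : ℕ) (A : ℤ) :
    modScalars (P2Expr ε κ A) = ((reExp ε κ).map fun e =>
      oneAddClass (A - e) * oneAddClass (A + e) /
        (oneAddClass (A + 1 - e) * oneAddClass (A + 1 + e))).prod := by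
  rw [P2Expr, modScalars_multiset_prod]
  refine congrArg _ (Multiset.map_congr rfl fun e _ => ?_)
  simp only [← zpow_neg, ← zpow_add₀ qR_ne_zero, ← sub_eq_add_neg, map_div₀, map_mul]
  rfl

theorem modScalars_P3Expr (ε κ : ℕ) (A : ℤ) (hA : 2 * ((κ - 1 : ℕ) : ℤ) - 2 + ε < A) :
    modScalars (P3Expr ε κ A) = ((reExp ε (κ - 1)).map fun e =>
      oneSubClass (A - e) * oneSubClass (A + e) /
        (oneSubClass (A + 1 - e) * oneSubClass (A + 1 + e))).prod := by
  rw [P3Expr, modScalars_multiset_prod]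
  refine congrArg _ (Multiset.map_congr rfl fun e he => ?_)
  have := mem_reExp he
  rw [oneSubClass_of_ne_zero (by omega), oneSubClass_of_ne_zero (by omega),
    oneSubClass_of_ne_zero (by omega), oneSubClass_of_ne_zero (by omega)]
  simp only [← zpow_neg, ← zpow_add₀ qR_ne_zero, ← sub_eq_add_neg, map_div₀, map_mul]

theorem modScalars_P4aExpr (N : ℕ) :
    modScalars (P4aExpr N) = ∏ j ∈ Finset.range N, ∏ i ∈ Finset.range j,
      oneSubClass (j - i) ^ 2 / (oneSubClass (j - i + 1) * oneSubClass (j - i - 1)) := by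
  rw [P4aExpr, Finset.prod_filter, ← Finset.prod_mul_distrib, ← Finset.prod_div_distrib,
    prod_pairsUpTo, map_prod]
  refine Finset.prod_congr rfl fun j _ => ?_
  rw [map_prod]
  refine Finset.prod_congr rfl fun i hi => ?_
  rw [Finset.mem_range] at hi
  rw [oneSubClass_of_ne_zero (by omega), oneSubClass_of_ne_zero (by omega),
    ← modScalars_ite (j - i - 1) (¬ 2 ≤ j + 1 - (i + 1)) (by omega), ite_not,
    ← map_pow, ← map_mul, ← map_div₀]
  simp only [← zpow_natCast]
  rw [show ((j + 1 - (i + 1) : ℕ) : ℤ) = j - i by omega,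
    show ((j + 1 - (i + 1) + 1 : ℕ) : ℤ) = j - i + 1 by omega]
  congr 4
  rw [show ((j + 1 - (i + 1) - 1 : ℕ) : ℤ) = j - i - 1 by omega]

theorem modScalars_P4dExpr (δ A : ℕ) :
    modScalars (P4dExpr δ A) = ∏ j ∈ Finset.range (A + 1 - δ), ∏ i ∈ Finset.range j,
      oneSubClass (i + j + 2 * δ) ^ 2 /
        (oneSubClass (i + j + 2 * δ + 1) * oneSubClass (i + j + 2 * δ - 1)) := by
  rw [P4dExpr, Finset.prod_filter, ← Finset.prod_mul_distrib, ← Finset.prod_div_distrib,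
    prod_pairsUpTo, map_prod]
  refine Finset.prod_congr rfl fun j _ => ?_
  rw [map_prod]
  refine Finset.prod_congr rfl fun i hi => ?_
  rw [Finset.mem_range] at hi
  rw [oneSubClass_of_ne_zero (by omega), oneSubClass_of_ne_zero (by omega),
    ← modScalars_ite (i + j + 2 * δ - 1) (¬ (i + 1) + (j + 1) + 2 * δ - 3 ≠ 0) (by omega),
    ← map_pow, ← map_mul, ← map_div₀]
  simp only [← zpow_natCast, ne_eq, ite_not]
  rw [show (((i + 1) + (j + 1) + 2 * δ - 2 : ℕ) : ℤ) = i + j + 2 * δ by omega,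
    show (((i + 1) + (j + 1) + 2 * δ - 1 : ℕ) : ℤ) = i + j + 2 * δ + 1 by omega,
    show (((i + 1) + (j + 1) + 2 * δ - 3 : ℕ) : ℤ) = i + j + 2 * δ - 1 by omega]

theorem statement13 (κm κp εm εp δm δp : ℕ)
    (hεm : εm = 0 ∨ εm = 1) (hεp : εp = 0 ∨ εp = 1)
    (hδm : δm = κm % 2) (hδp : δp = κp % 2)
    (mminus mplus : ℚ)
    (hmm : mminus = κm + (2 * (εm : ℚ) - 1) / 4)
    (hmp : mplus = κp + (2 * (εp : ℚ) - 1) / 4)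
    (h0 : 0 < mminus) (hle : mminus ≤ mplus) (h1 : 1 < mplus)
    (Ap : ℕ) (hAp : (Ap : ℤ) = 2 * (κp : ℤ) - 2 + εp)
    (Am : ℤ) (hAm : Am = 2 * (κm : ℤ) - 2 + εm) :
    ∃ c : ℚ, c ≠ 0 ∧ ∃ k₀ : ℤ,
      P1Expr δm δp Ap * P2Expr εm κm Ap * P3Expr εp κp Ap *
          P4aExpr (Ap + 1 - δp) * P4dExpr δp Ap =
        algebraMap ℚ RF13 c * vR ^ k₀ *
          ((1 - qR) ^ (Ap + 1 - δp) * (1 + qR) ^ ((-1 : ℤ) ^ (1 - δp) * (δm : ℤ)) /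
            ((∏ k ∈ Finset.Icc (1 : ℤ) ((Ap : ℤ) - Am - 1), (1 + qR ^ k)) *
              ∏ i ∈ Finset.Icc (0 : ℤ) Am, (1 + qR ^ ((Ap : ℤ) - Am + 1 + 2 * i)))) := by
  apply exists_eq_of_modScalars_eq
  subst hmm hmp
  have hκp : 1 ≤ κp := by
    by_contra! h
    obtain rfl : κp = 0 := by omega
    rcases hεp with rfl | rfl <;> norm_num at h1
  obtain ⟨t, rfl⟩ : ∃ t, κp = t + 1 := ⟨κp - 1, by omega⟩
  have hAm0 : -1 ≤ Am := by
    by_contra! h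
    obtain rfl : κm = 0 := by omega
    obtain rfl : εm = 0 := by omega
    norm_num at h0
  have hAmp : Am ≤ Ap := by
    rw [hAm, hAp]
    push_cast at hle
    qify
    linarith
  obtain ⟨n, hn⟩ : ∃ n : ℕ, (n : ℤ) = Am + 1 := ⟨(Am + 1).toNat, by omega⟩
  obtain ⟨h, hh⟩ : ∃ h : ℕ, (h : ℤ) = Ap - Am := ⟨(Ap - Am).toNat, by omega⟩
  have hsub : modScalars (1 - qR) = oneSubClass 1 := by
    rw [oneSubClass_of_ne_zero one_ne_zero, zpow_one]
  have hadd : modScalars (1 + qR) = oneAddClass 1 := by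
    rw [oneAddClass, zpow_one]
  have key := even_prod_identity oneSubClass oneAddClass oneSubClass_ne_zero oneAddClass_ne_zero
    oneSubClass_zero oneAddClass_zero oneAddClass_neg oneSubClass_two_mul κm t εm εp δm δp Ap n h
    hεm hεp hδm hδp (by push_cast at hAp; omega) (by omega) (by omega)
  rw [map_mul, map_mul, map_mul, map_mul, modScalars_P1Expr, modScalars_P2Expr,
    modScalars_P3Expr _ _ _ (by push_cast at hAp ⊢; omega), modScalars_P4aExpr,
    modScalars_P4dExpr, Nat.add_sub_cancel, key, map_div₀, map_mul, map_mul, map_pow, map_zpow₀,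
    hsub, hadd, map_prod, map_prod,
    prod_Icc_one_int_eq_prod_range (fun k => modScalars (1 + qR ^ k)),
    prod_Icc_zero_int_eq_prod_range (fun i => modScalars (1 + qR ^ ((Ap : ℤ) - Am + 1 + 2 * i))),
    ← hh, ← hn, show ((h : ℤ) - 1).toNat = h - 1 by omega, Int.toNat_natCast]
  rfl
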